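/- Let ℓ be a 1-Lipschitz function with ℓ(0) = 0, ℓ_σ = ℓ ∗ φ_σ, and define v(θ) = e^θ(ℓ_σ(θ) − ℓ_σ(0)). Then for every integer k ≥ 0 and every θ ∈ [0, θ*], |v^{(k)}(θ)| ≤ C(θ*, σ²)(k+1)^{1/2} 2^{k−1}(1 + (k/(eσ²))^{k/2}), for a constant C(θ*, σ²) > 0 depending only on θ* and σ². -/

import Mathlib

open MeasureTheory Real

noncomputable section

/-- The density of `N(0, σ²)`. -/
def gaussPDF (σ : ℝ) (y : ℝ) : ℝ :=
  Real.exp (-(y ^ 2) / (2 * σ ^ 2)) / (σ * Real.sqrt (2 * Real.pi))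

/-- Gaussian smoothing `ℓ_σ = ℓ ∗ φ_σ` of a function `ℓ`. -/
def smooth (σ : ℝ) (l : ℝ → ℝ) (θ : ℝ) : ℝ := ∫ y, l (θ - y) * gaussPDF σ y

open Polynomial in
/-- Polynomials with `φ^{(n)} = P_n φ`. -/
def hp (c : ℝ) : ℕ → Polynomial ℝ
  | 0 => 1
  | n + 1 => derivative (hp c n) - C c * X * hp c n

open Polynomial in
lemma hp_deriv (c : ℝ) (n : ℕ) :
    derivative (hp c (n + 1)) = C (-((n : ℝ) + 1) * c) * hp c n := by
  induction n with
  | zero => simp [hp]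
  | succ n ih =>
    have h1 : hp c (n + 1 + 1) = derivative (hp c (n + 1)) - C c * X * hp c (n + 1) := rfl
    have h2 : hp c (n + 1) = derivative (hp c n) - C c * X * hp c n := rfl
    rw [h1, derivative_sub, derivative_mul, ih]
    simp only [derivative_mul, derivative_C, derivative_X, zero_mul, zero_add, mul_one]
    have h3 : derivative (hp c n) = hp c (n + 1) + C c * X * hp c n := by rw [h2]; ring
    rw [h3]
    push_cast
    simp only [C_mul, C_neg, C_add, C_1]
    ring

lemma poly_bound (b : ℝ) (hb : 0 < b) (p : Polynomial ℝ) :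
    ∃ K, 0 ≤ K ∧ ∀ z : ℝ, |p.eval z| ≤ K * Real.exp (b * z ^ 2) := by
  induction p using Polynomial.induction_on' with
  | add p q hp hq =>
    obtain ⟨K, hK, h⟩ := hp
    obtain ⟨L, hL, h'⟩ := hq
    refine ⟨K + L, by positivity, fun z => ?_⟩
    rw [Polynomial.eval_add, add_mul]
    exact (abs_add_le _ _).trans (add_le_add (h z) (h' z))
  | monomial n a =>
    refine ⟨|a| * (1 + n.factorial / b ^ n), by positivity, fun z => ?_⟩
    rw [Polynomial.eval_monomial, abs_mul, mul_assoc]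
    gcongr
    have h1 := Real.pow_div_factorial_le_exp _ (show 0 ≤ b * z ^ 2 by positivity) n
    have h2 : 1 ≤ Real.exp (b * z ^ 2) := Real.one_le_exp (by positivity)
    have h3 : (z ^ 2) ^ n ≤ n.factorial / b ^ n * Real.exp (b * z ^ 2) := by
      rw [div_le_iff₀ (by positivity), mul_pow] at h1
      rw [div_mul_eq_mul_div, le_div_iff₀ (by positivity)]
      linarith
    have h4 : |z ^ n| ≤ 1 + (z ^ 2) ^ n := by
      rw [← pow_mul, mul_comm, pow_mul, ← sq_abs (z ^ n)]
      nlinarith [sq_nonneg (|z ^ n| - 1), abs_nonneg (z ^ n)]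
    linarith

lemma gaussPDF_eq (σ y : ℝ) :
    gaussPDF σ y = (σ * Real.sqrt (2 * Real.pi))⁻¹ * Real.exp (-(1 / (2 * σ ^ 2)) * y ^ 2) := by
  unfold gaussPDF
  rw [div_eq_inv_mul]
  congr 2
  ring

lemma gaussPDF_pos (σ y : ℝ) (hσ : 0 < σ) : 0 < gaussPDF σ y := by
  unfold gaussPDF; positivity

lemma gaussPDF_cont (σ : ℝ) : Continuous (gaussPDF σ) := by
  unfold gaussPDF
  fun_prop

lemma gaussPDF_deriv (σ y : ℝ) (hσ : 0 < σ) :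
    HasDerivAt (gaussPDF σ) (-(1 / σ ^ 2) * y * gaussPDF σ y) y := by
  have h : gaussPDF σ = fun y => (σ * Real.sqrt (2 * Real.pi))⁻¹ *
      Real.exp (-(1 / (2 * σ ^ 2)) * y ^ 2) := funext (gaussPDF_eq σ)
  rw [h]
  have := ((((hasDerivAt_id y).pow 2).const_mul (-(1 / (2 * σ ^ 2)))).exp).const_mul
    ((σ * Real.sqrt (2 * Real.pi))⁻¹)
  convert! this using 1
  simp
  field_simp

lemma gaussPDF_integral (σ : ℝ) (hσ : 0 < σ) : ∫ y, gaussPDF σ y = 1 := by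
  simp_rw [gaussPDF_eq]
  rw [integral_const_mul, integral_gaussian]
  have : π / (1 / (2 * σ ^ 2)) = (2 * π) * σ ^ 2 := by field_simp
  rw [this, Real.sqrt_mul (show 0 ≤ 2 * π by positivity) (σ ^ 2), Real.sqrt_sq hσ.le]
  have : 0 < √(2 * π) := by positivity
  field_simp

lemma poly_gauss_bound (σ : ℝ) (hσ : 0 < σ) (p : Polynomial ℝ) :
    ∃ K, 0 ≤ K ∧ ∀ z : ℝ, |p.eval z * gaussPDF σ z| ≤
      K * Real.exp (-(1 / (4 * σ ^ 2)) * z ^ 2) := by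
  obtain ⟨K, hK, h⟩ := poly_bound (1 / (4 * σ ^ 2)) (by positivity) p
  refine ⟨K * (σ * Real.sqrt (2 * Real.pi))⁻¹, by positivity, fun z => ?_⟩
  rw [abs_mul, abs_of_pos (gaussPDF_pos σ z hσ), gaussPDF_eq]
  have e : Real.exp (-(1 / (4 * σ ^ 2)) * z ^ 2) =
    Real.exp (1 / (4 * σ ^ 2) * z ^ 2) * Real.exp (-(1 / (2 * σ ^ 2)) * z ^ 2) := by
    rw [← Real.exp_add]; congr 1; field_simp; ring
  rw [e]
  calc _ ≤ (K * Real.exp (1 / (4 * σ ^ 2) * z ^ 2)) * ((σ * Real.sqrt (2 * Real.pi))⁻¹ *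
        Real.exp (-(1 / (2 * σ ^ 2)) * z ^ 2)) := by gcongr; exact h z
    _ = _ := by ring

lemma poly_gauss_cont (σ : ℝ) (p : Polynomial ℝ) :
    Continuous (fun z => p.eval z * gaussPDF σ z) :=
  p.continuous.mul (gaussPDF_cont σ)

lemma poly_gauss_integrable (σ : ℝ) (hσ : 0 < σ) (p : Polynomial ℝ) :
    Integrable (fun z => p.eval z * gaussPDF σ z) := by
  obtain ⟨K, hK, h⟩ := poly_gauss_bound σ hσ p
  refine Integrable.mono' ((integrable_exp_neg_mul_sq
    (show 0 < 1 / (4 * σ ^ 2) by positivity)).const_mul K)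
    (poly_gauss_cont σ p).aestronglyMeasurable (Filter.Eventually.of_forall h)

lemma hp_gauss_deriv (σ : ℝ) (hσ : 0 < σ) (n : ℕ) (y : ℝ) :
    HasDerivAt (fun z => (hp (1 / σ ^ 2) n).eval z * gaussPDF σ z)
      ((hp (1 / σ ^ 2) (n + 1)).eval y * gaussPDF σ y) y := by
  convert! ((hp (1 / σ ^ 2) n).hasDerivAt y).mul (gaussPDF_deriv σ y hσ) using 1
  simp [hp]
  ring

lemma hp_sq_integral (σ : ℝ) (hσ : 0 < σ) (n : ℕ) :
    ∫ z, (hp (1 / σ ^ 2) n).eval z ^ 2 * gaussPDF σ z = n.factorial * (1 / σ ^ 2) ^ n := by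
  induction n with
  | zero => simpa [hp] using gaussPDF_integral σ hσ
  | succ n ih =>
    set c := 1 / σ ^ 2 with hc
    have key := integral_mul_deriv_eq_deriv_mul_of_integrable
      (u := fun z => (hp c (n + 1)).eval z)
      (u' := fun z => (-((n : ℝ) + 1) * c) * (hp c n).eval z)
      (v := fun z => (hp c n).eval z * gaussPDF σ z)
      (v' := fun z => (hp c (n + 1)).eval z * gaussPDF σ z)
      (fun x _ => by
        have := (hp c (n + 1)).hasDerivAt x
        rw [hp_deriv] at this
        simpa using this)
      (fun x _ => hp_gauss_deriv σ hσ n x)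
      (by
        have := poly_gauss_integrable σ hσ (hp c (n + 1) * hp c (n + 1))
        refine this.congr (Filter.Eventually.of_forall fun z => ?_)
        simp; ring)
      (by
        have := (poly_gauss_integrable σ hσ (hp c n * hp c n)).const_mul (-((n : ℝ) + 1) * c)
        refine this.congr (Filter.Eventually.of_forall fun z => ?_)
        simp; ring)
      (by
        have := poly_gauss_integrable σ hσ (hp c (n + 1) * hp c n)
        refine this.congr (Filter.Eventually.of_forall fun z => ?_)
        simp; ring)
    calc _ = ∫ z, (hp c (n + 1)).eval z * ((hp c (n + 1)).eval z * gaussPDF σ z) := by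
          congr 1; ext z; ring
      _ = -∫ z, (-((n : ℝ) + 1) * c) * (hp c n).eval z * ((hp c n).eval z * gaussPDF σ z) := key
      _ = -∫ z, (-((n : ℝ) + 1) * c) * ((hp c n).eval z ^ 2 * gaussPDF σ z) := by
          congr 2; ext z; ring
      _ = _ := by
          rw [integral_const_mul, ih, Nat.factorial_succ]; push_cast; ring

lemma hp_abs_integral (σ : ℝ) (hσ : 0 < σ) (n : ℕ) :
    ∫ z, |(hp (1 / σ ^ 2) n).eval z * gaussPDF σ z| ≤
      Real.sqrt (n.factorial * (1 / σ ^ 2) ^ n) := by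
  set c := 1 / σ ^ 2 with hc
  set s := Real.sqrt (n.factorial * c ^ n) with hs
  have hs0 : 0 < s := by positivity
  have hs2 : s ^ 2 = n.factorial * c ^ n := Real.sq_sqrt (by positivity)
  have hi1 : Integrable (fun z => (hp c n).eval z ^ 2 * gaussPDF σ z) := by
    refine (poly_gauss_integrable σ hσ (hp c n * hp c n)).congr
      (Filter.Eventually.of_forall fun z => ?_)
    simp only [Polynomial.eval_mul]
    ring
  have hi0 : Integrable (gaussPDF σ) := by
    simpa using poly_gauss_integrable σ hσ 1
  calc _ ≤ ∫ z, (1 / (2 * s) * ((hp c n).eval z ^ 2 * gaussPDF σ z) + s / 2 * gaussPDF σ z) := by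
        refine integral_mono (poly_gauss_integrable σ hσ (hp c n)).abs
          ((hi1.const_mul _).add (hi0.const_mul _)) fun z => ?_
        simp only [abs_mul, abs_of_pos (gaussPDF_pos σ z hσ)]
        rw [← mul_assoc, ← add_mul]
        refine mul_le_mul_of_nonneg_right ?_ (gaussPDF_pos σ z hσ).le
        rw [← sq_abs]
        have : 1 / (2 * s) * |(hp c n).eval z| ^ 2 + s / 2 - |(hp c n).eval z| =
          1 / (2 * s) * (|(hp c n).eval z| - s) ^ 2 := by field_simp; ring
        have h2 : 0 ≤ 1 / (2 * s) * (|(hp c n).eval z| - s) ^ 2 := by positivity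
        linarith
    _ = s := by
        rw [integral_add (hi1.const_mul _) (hi0.const_mul _), integral_const_mul,
          integral_const_mul, hp_sq_integral σ hσ n, gaussPDF_integral σ hσ, ← hc, ← hs2]
        field_simp; ring

/-- `g_n = ℓ ∗ φ^{(n)}`. -/
def gs (σ : ℝ) (l : ℝ → ℝ) (n : ℕ) (θ : ℝ) : ℝ :=
  ∫ y, l (θ - y) * ((hp (1 / σ ^ 2) n).eval y * gaussPDF σ y)

lemma lip_abs {l : ℝ → ℝ} (hl : LipschitzWith 1 l) (x y : ℝ) : |l x - l y| ≤ |x - y| := by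
  simpa [Real.dist_eq] using hl.dist_le_mul x y

/-- the dominating function -/
lemma dom_integrable (b : ℝ) (hb : 0 < b) (K A θ : ℝ) :
    Integrable (fun y : ℝ => K * ((A + |θ - y|) * Real.exp (-b * (θ - y) ^ 2))) := by
  have h1 := (integrable_exp_neg_mul_sq hb).const_mul A
  have h2 := (integrable_mul_exp_neg_mul_sq hb).abs
  have h3 := ((h1.add h2).const_mul K).comp_sub_left θ
  refine h3.congr (Filter.Eventually.of_forall fun z => ?_)
  simp only [Pi.add_apply, abs_mul, Real.abs_exp]
  ring

lemma gs_alt (σ : ℝ) (l : ℝ → ℝ) (n : ℕ) (θ : ℝ) :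
    gs σ l n θ = ∫ y, l y * ((hp (1 / σ ^ 2) n).eval (θ - y) * gaussPDF σ (θ - y)) := by
  unfold gs
  rw [← integral_sub_left_eq_self _ volume θ]
  simp

lemma dom_bound (σ : ℝ) (hσ : 0 < σ) (l : ℝ → ℝ) (hl : LipschitzWith 1 l) (h0 : l 0 = 0)
    (n : ℕ) (θ : ℝ) : ∃ K, ∀ y, ∀ x ∈ Metric.ball θ 1,
      ‖l y * ((hp (1 / σ ^ 2) n).eval (x - y) * gaussPDF σ (x - y))‖ ≤
        K * ((|θ| + |θ - y|) * Real.exp (-(1 / (8 * σ ^ 2)) * (θ - y) ^ 2)) := by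
  obtain ⟨K, hK, h⟩ := poly_gauss_bound σ hσ (hp (1 / σ ^ 2) n)
  refine ⟨K * Real.exp (1 / (4 * σ ^ 2)), fun y x hx => ?_⟩
  rw [Metric.mem_ball, Real.dist_eq] at hx
  have hly : |l y| ≤ |θ| + |θ - y| := by
    have h1 := lip_abs hl y 0
    rw [h0, sub_zero, sub_zero] at h1
    have h2 : |y| ≤ |θ| + |θ - y| := by
      have := abs_sub θ (θ - y)
      simpa using this
    linarith
  have hexp : Real.exp (-(1 / (4 * σ ^ 2)) * (x - y) ^ 2) ≤
      Real.exp (1 / (4 * σ ^ 2)) * Real.exp (-(1 / (8 * σ ^ 2)) * (θ - y) ^ 2) := by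
    rw [← Real.exp_add, Real.exp_le_exp]
    have h1 : (x - θ) ^ 2 ≤ 1 := by
      rw [← sq_abs]; nlinarith [abs_nonneg (x - θ)]
    have h2 : (θ - y) ^ 2 / 2 - 1 ≤ (x - y) ^ 2 := by
      nlinarith [sq_nonneg ((x - y) + (x - θ))]
    have h3 : 1 / (8 * σ ^ 2) = 1 / (4 * σ ^ 2) * (1 / 2) := by field_simp; norm_num
    rw [h3]
    have h4 : 0 ≤ 1 / (4 * σ ^ 2) := by positivity
    nlinarith [mul_le_mul_of_nonneg_left h2 h4]
  rw [Real.norm_eq_abs, abs_mul]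
  calc _ ≤ (|θ| + |θ - y|) * (K * (Real.exp (1 / (4 * σ ^ 2)) *
        Real.exp (-(1 / (8 * σ ^ 2)) * (θ - y) ^ 2))) := by
        gcongr
        exact (h _).trans (by gcongr)
    _ = _ := by ring

lemma gs_integrable (σ : ℝ) (hσ : 0 < σ) (l : ℝ → ℝ) (hl : LipschitzWith 1 l) (h0 : l 0 = 0)
    (n : ℕ) (θ : ℝ) :
    Integrable fun y => l y * ((hp (1 / σ ^ 2) n).eval (θ - y) * gaussPDF σ (θ - y)) := by
  obtain ⟨K, h⟩ := dom_bound σ hσ l hl h0 n θ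
  refine Integrable.mono' (dom_integrable (1 / (8 * σ ^ 2)) (by positivity) K |θ| θ) ?_
    (Filter.Eventually.of_forall fun y => h y θ (Metric.mem_ball_self one_pos))
  exact (hl.continuous.mul ((poly_gauss_cont σ _).comp
    (continuous_const.sub continuous_id))).aestronglyMeasurable

lemma gs_hasDerivAt (σ : ℝ) (hσ : 0 < σ) (l : ℝ → ℝ) (hl : LipschitzWith 1 l) (h0 : l 0 = 0)
    (n : ℕ) (θ : ℝ) : HasDerivAt (gs σ l n) (gs σ l (n + 1) θ) θ := by
  rw [show gs σ l n = _ from funext (gs_alt σ l n), gs_alt]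
  obtain ⟨K, h⟩ := dom_bound σ hσ l hl h0 (n + 1) θ
  refine (hasDerivAt_integral_of_dominated_loc_of_deriv_le (Metric.ball_mem_nhds θ one_pos)
    (F' := fun x y => l y * ((hp (1 / σ ^ 2) (n + 1)).eval (x - y) * gaussPDF σ (x - y)))
    (Filter.Eventually.of_forall fun x => (gs_integrable σ hσ l hl h0 n x).aestronglyMeasurable)
    (gs_integrable σ hσ l hl h0 n θ)
    (gs_integrable σ hσ l hl h0 (n + 1) θ).aestronglyMeasurable
    (Filter.Eventually.of_forall h)
    (dom_integrable (1 / (8 * σ ^ 2)) (by positivity) K |θ| θ)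
    (Filter.Eventually.of_forall fun y x _ => ?_)).2
  exact ((hp_gauss_deriv σ hσ n (x - y)).comp_sub_const x y).const_mul (l y)

lemma gs_lip (σ : ℝ) (hσ : 0 < σ) (l : ℝ → ℝ) (hl : LipschitzWith 1 l) (h0 : l 0 = 0)
    (n : ℕ) (θ θ' : ℝ) : |gs σ l n θ - gs σ l n θ'| ≤
      Real.sqrt (n.factorial * (1 / σ ^ 2) ^ n) * |θ - θ'| := by
  have hi : ∀ t, Integrable fun y => l (t - y) * ((hp (1 / σ ^ 2) n).eval y * gaussPDF σ y) := by
    intro t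
    simpa using (gs_integrable σ hσ l hl h0 n t).comp_sub_left t
  unfold gs
  rw [← integral_sub (hi θ) (hi θ')]
  refine abs_integral_le_integral_abs.trans ?_
  refine le_trans ?_ (mul_le_mul_of_nonneg_right (hp_abs_integral σ hσ n) (abs_nonneg _))
  rw [← integral_mul_const]
  refine integral_mono ((hi θ).sub (hi θ')).abs
    ((poly_gauss_integrable σ hσ (hp _ n)).abs.mul_const _) fun y => ?_
  simp only
  rw [← sub_mul, abs_mul, mul_comm]
  refine mul_le_mul_of_nonneg_left ?_ (abs_nonneg _)
  simpa using lip_abs hl (θ - y) (θ' - y)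

lemma gs_succ_bound (σ : ℝ) (hσ : 0 < σ) (l : ℝ → ℝ) (hl : LipschitzWith 1 l) (h0 : l 0 = 0)
    (n : ℕ) (θ : ℝ) : |gs σ l (n + 1) θ| ≤ Real.sqrt (n.factorial * (1 / σ ^ 2) ^ n) := by
  rw [← (gs_hasDerivAt σ hσ l hl h0 n θ).deriv]
  exact norm_deriv_le_of_lip' (f := gs σ l n) (x₀ := θ) (Real.sqrt_nonneg _)
    (Filter.Eventually.of_forall fun x => gs_lip σ hσ l hl h0 n x θ)

lemma exp_mul_iter (k : ℕ) : ∀ (w : ℕ → ℝ → ℝ), (∀ j t, HasDerivAt (w j) (w (j + 1) t) t) →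
    ∀ (θ M : ℝ), (∀ j ≤ k, |w j θ| ≤ M) →
    |iteratedDeriv k (fun t => Real.exp t * w 0 t) θ| ≤ Real.exp θ * (2 ^ k * M) := by
  induction k with
  | zero =>
    intro w _ θ M hM
    simp only [iteratedDeriv_zero, abs_mul, Real.abs_exp, pow_zero, one_mul]
    have := hM 0 le_rfl
    gcongr
  | succ k ih =>
    intro w hw θ M hM
    have hd : deriv (fun t => Real.exp t * w 0 t) = fun t => Real.exp t * (w 0 t + w 1 t) := by
      ext t
      rw [((Real.hasDerivAt_exp t).fun_mul (hw 0 t)).deriv]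
      ring
    rw [iteratedDeriv_succ', hd]
    have := ih (fun j t => w j t + w (j + 1) t) (fun j t => (hw j t).add (hw (j + 1) t)) θ (2 * M)
      (fun j hj => by
        have h1 := hM j (by omega)
        have h2 := hM (j + 1) (by omega)
        have h3 := abs_add_le (w j θ) (w (j + 1) θ)
        linarith)
    refine this.trans (le_of_eq ?_)
    ring

lemma fact_bound (n : ℕ) : (n.factorial : ℝ) * Real.exp 1 ^ n ≤ ((n : ℝ) + 1) ^ (n + 1) := by
  induction n with
  | zero => simp
  | succ n ih =>
    have h1 : ((n : ℝ) + 1) / (n + 2) ≤ Real.exp (-(1 / ((n : ℝ) + 2))) := by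
      have := Real.add_one_le_exp (-(1 / ((n : ℝ) + 2)))
      refine le_trans (le_of_eq ?_) this
      field_simp; ring
    have h2 : (((n : ℝ) + 1) / (n + 2)) ^ (n + 2) ≤ Real.exp (-1) := by
      refine (pow_le_pow_left₀ (by positivity) h1 (n + 2)).trans (le_of_eq ?_)
      rw [← Real.exp_nat_mul]
      congr 1
      push_cast; field_simp
    rw [div_pow, div_le_iff₀ (by positivity)] at h2
    have h3 : Real.exp 1 * Real.exp (-1) = 1 := by rw [← Real.exp_add]; simp
    have h4 := mul_le_mul_of_nonneg_left h2 (Real.exp_pos 1).le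
    rw [← mul_assoc, h3, one_mul] at h4
    rw [Nat.factorial_succ]
    push_cast
    calc _ = ((n : ℝ) + 1) * Real.exp 1 * (n.factorial * Real.exp 1 ^ n) := by ring
      _ ≤ ((n : ℝ) + 1) * Real.exp 1 * ((n : ℝ) + 1) ^ (n + 1) := by gcongr
      _ = Real.exp 1 * ((n : ℝ) + 1) ^ (n + 2) := by ring
      _ ≤ _ := h4
      _ = _ := by ring

lemma coeff_bound (σ : ℝ) (hσ : 0 < σ) (n k : ℕ) (hk : n + 1 ≤ k) :
    Real.sqrt (n.factorial * (1 / σ ^ 2) ^ n) ≤ (σ * Real.sqrt (Real.exp 1)) *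
      (1 + ((k : ℝ) / (Real.exp 1 * σ ^ 2)) ^ ((k : ℝ) / 2)) := by
  have hE := Real.exp_pos 1
  set E := Real.exp 1 with hEd
  have h1 : (n.factorial : ℝ) * (1 / σ ^ 2) ^ n ≤
      (σ ^ 2 * E) * (((n : ℝ) + 1) / (E * σ ^ 2)) ^ (n + 1) := by
    have e1 : (σ ^ 2 * E) * (((n : ℝ) + 1) / (E * σ ^ 2)) ^ (n + 1) =
        ((n : ℝ) + 1) ^ (n + 1) / E ^ n * (1 / σ ^ 2) ^ n := by
      rw [div_pow, mul_pow, one_div, inv_pow]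
      field_simp
      ring
    rw [e1]
    gcongr
    rw [le_div_iff₀ (by positivity)]
    exact fact_bound n
  have h2 : (((n : ℝ) + 1) / (E * σ ^ 2)) ^ (n + 1) ≤ max 1 (((k : ℝ) / (E * σ ^ 2)) ^ k) := by
    have hk' : (n : ℝ) + 1 ≤ k := by exact_mod_cast hk
    rcases le_total (((n : ℝ) + 1) / (E * σ ^ 2)) 1 with h | h
    · exact le_max_of_le_left (pow_le_one₀ (by positivity) h)
    · refine le_max_of_le_right ?_
      refine (pow_le_pow_right₀ h hk).trans ?_
      gcongr
  set q : ℝ := (k : ℝ) / (E * σ ^ 2) with hq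
  have hq0 : 0 ≤ q := by positivity
  rw [Real.rpow_div_two_eq_sqrt _ hq0, Real.rpow_natCast]
  have hr0 : 0 ≤ √q ^ k := by positivity
  have hr2 : (√q ^ k) ^ 2 = q ^ k := by
    rw [← pow_mul, mul_comm, pow_mul, Real.sq_sqrt hq0]
  have h3 : max 1 (q ^ k) ≤ (1 + √q ^ k) ^ 2 := by
    rw [← hr2]
    refine max_le ?_ ?_ <;> nlinarith
  refine Real.sqrt_le_iff.2 ⟨by positivity, ?_⟩
  rw [mul_pow, mul_pow, Real.sq_sqrt hE.le]
  refine h1.trans ?_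
  gcongr
  exact h2.trans h3

/-- derivative bounds for `v(θ) = e^θ (ℓ_σ(θ) - ℓ_σ(0))` on `[0, θ*]`. -/
theorem stmt8 (θs σ : ℝ) (hθ : 0 < θs) (hσ : 0 < σ) :
    ∃ C > (0:ℝ),
    ∀ l : ℝ → ℝ, LipschitzWith 1 l → l 0 = 0 →
    ∀ k : ℕ, ∀ θ ∈ Set.Icc (0:ℝ) θs,
      |iteratedDeriv k (fun t => Real.exp t * (smooth σ l t - smooth σ l 0)) θ| ≤
        C * Real.sqrt (k + 1) * (2:ℝ) ^ ((k : ℝ) - 1) *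
          (1 + ((k : ℝ) / (Real.exp 1 * σ ^ 2)) ^ ((k : ℝ) / 2)) := by
  refine ⟨2 * Real.exp θs * (θs + σ * Real.sqrt (Real.exp 1)), by positivity,
    fun l hl h0 k θ hθm => ?_⟩
  set B := 1 + ((k : ℝ) / (Real.exp 1 * σ ^ 2)) ^ ((k : ℝ) / 2) with hB
  have hB1 : 1 ≤ B := by
    have : 0 ≤ ((k : ℝ) / (Real.exp 1 * σ ^ 2)) ^ ((k : ℝ) / 2) := by positivity
    linarith
  have hs : smooth σ l = gs σ l 0 := by
    ext t; simp [smooth, gs, hp]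
  let w : ℕ → ℝ → ℝ := fun j t => match j with
    | 0 => gs σ l 0 t - gs σ l 0 0
    | j + 1 => gs σ l (j + 1) t
  have hw : ∀ j t, HasDerivAt (w j) (w (j + 1) t) t := by
    intro j t
    cases j with
    | zero => exact (gs_hasDerivAt σ hσ l hl h0 0 t).sub_const _
    | succ j => exact gs_hasDerivAt σ hσ l hl h0 (j + 1) t
  have hM : ∀ j ≤ k, |w j θ| ≤ (θs + σ * Real.sqrt (Real.exp 1)) * B := by
    intro j hj
    have hpos : 0 ≤ σ * Real.sqrt (Real.exp 1) := by positivity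
    cases j with
    | zero =>
      have h1 := gs_lip σ hσ l hl h0 0 θ 0
      simp only [Nat.factorial_zero, Nat.cast_one, pow_zero, mul_one, Real.sqrt_one, one_mul,
        sub_zero, abs_of_nonneg hθm.1] at h1
      show |gs σ l 0 θ - gs σ l 0 0| ≤ _
      nlinarith [hθm.2]
    | succ j =>
      have h1 := gs_succ_bound σ hσ l hl h0 j θ
      have h2 := coeff_bound σ hσ j k hj
      rw [← hB] at h2
      show |gs σ l (j + 1) θ| ≤ _
      nlinarith
  have key := exp_mul_iter k w hw θ _ hM
  rw [hs]
  refine key.trans ?_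
  have h2 : (2 : ℝ) ^ ((k : ℝ) - 1) = 2 ^ k / 2 := by
    rw [Real.rpow_sub two_pos, Real.rpow_natCast, Real.rpow_one]
  rw [h2]
  have h3 : 1 ≤ Real.sqrt (k + 1) := by
    rw [Real.one_le_sqrt]; have : (0:ℝ) ≤ k := Nat.cast_nonneg k
    linarith
  have h4 : Real.exp θ ≤ Real.exp θs := Real.exp_le_exp.2 hθm.2
  calc _ ≤ Real.exp θs * (2 ^ k * ((θs + σ * Real.sqrt (Real.exp 1)) * B)) := by gcongr
    _ ≤ Real.exp θs * (2 ^ k * ((θs + σ * Real.sqrt (Real.exp 1)) * B)) * Real.sqrt (k + 1) :=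
      le_mul_of_one_le_right (by positivity) h3
    _ = _ := by ring
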